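/- In a simple majority voting system with an odd number N = 2n+1 of voters, where a coalition is winning iff it contains at least n+1 voters, the Shapley-Shubik probability that voter 1 votes yes and the coalition of yes-voters is winning equals 3/8 + 1/(8N). -/

import Mathlib

/-- A sum of a function of the cardinality, over the finsets that contain `a`. -/
theorem sum_card_erase_of_mem {α M : Type*} [Fintype α] [DecidableEq α] [AddCommMonoid M]
    (a : α) (f : ℕ → M) :
    ∑ A ∈ Finset.univ.filter (fun A : Finset α => a ∈ A), f (A.erase a).card =
      ∑ k ∈ Finset.range (Fintype.card α), (Fintype.card α - 1).choose k • f k := by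
  have hcard : (Finset.univ.erase a).card = Fintype.card α - 1 := by
    rw [Finset.card_erase_of_mem (Finset.mem_univ a), Finset.card_univ]
  have hpos : Fintype.card α - 1 + 1 = Fintype.card α :=
    Nat.sub_add_cancel (Fintype.card_pos_iff.mpr ⟨a⟩)
  have h := Finset.sum_powerset_apply_card f (x := Finset.univ.erase a)
  rw [hcard, hpos] at h
  rw [← h]
  refine Finset.sum_bij' (fun A _ => A.erase a) (fun B _ => insert a B) ?_ ?_ ?_ ?_ ?_
  · intro A _
    exact Finset.mem_powerset.mpr (Finset.erase_subset_erase a (Finset.subset_univ A))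
  · intro B _
    simp
  · intro A hA
    exact Finset.insert_erase (Finset.mem_filter.mp hA).2
  · intro B hB
    exact Finset.erase_insert fun ha =>
      Finset.notMem_erase a Finset.univ (Finset.mem_powerset.mp hB ha)
  · intro A _
    rfl

/-- The number of `k + 1`-subsets through a fixed point, times their Shapley-Shubik weight. -/
theorem choose_mul_shapley_weight {m k : ℕ} (hk : k ≤ m) :
    (m.choose k : ℝ) * (1 / ((((m + 1 : ℕ) : ℝ) + 1) * ((m + 1).choose (k + 1) : ℝ))) =
      ((k : ℝ) + 1) / (((m : ℝ) + 1) * ((m : ℝ) + 2)) := by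
  have h : ((m : ℝ) + 1) * m.choose k = (m + 1).choose (k + 1) * ((k : ℝ) + 1) := by
    exact_mod_cast Nat.add_one_mul_choose_eq m k
  have hc : ((m + 1).choose (k + 1) : ℝ) ≠ 0 := by
    exact_mod_cast (Nat.choose_pos (Nat.succ_le_succ hk)).ne'
  push_cast
  rw [mul_one_div, div_eq_div_iff (by positivity) (by positivity)]
  linear_combination ((m : ℝ) + 2) * h

theorem sum_range_add_add_one (n l : ℕ) :
    ∑ i ∈ Finset.range l, (((n + i : ℕ) : ℝ) + 1) = (l : ℝ) * (2 * n + l + 1) / 2 := by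
  induction l with
  | zero => simp
  | succ l ih =>
    rw [Finset.sum_range_succ, ih]
    push_cast
    ring

open scoped Classical

/-- In a simple majority voting system with an odd number `N = 2n+1` of voters,
the Shapley-Shubik probability that voter 1 votes yes and the coalition of
yes-voters is winning equals `3/8 + 1/(8N)`. -/
theorem shapley_shubik_affirmative_success_odd (n : ℕ) :
    (∑ A ∈ Finset.univ.filter
        (fun A : Finset (Fin (2 * n + 1)) =>
          (⟨0, by omega⟩ : Fin (2 * n + 1)) ∈ A ∧
            n ≤ (A.erase (⟨0, by omega⟩ : Fin (2 * n + 1))).card),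
      1 / ((((2 * n + 1 : ℕ) : ℝ) + 1) * ((2 * n + 1).choose A.card : ℝ)))
      = 3 / 8 + 1 / (8 * ((2 * n + 1 : ℕ) : ℝ)) := by
  set a : Fin (2 * n + 1) := ⟨0, by omega⟩
  let f : ℕ → ℝ := fun k =>
    if n ≤ k then 1 / ((((2 * n + 1 : ℕ) : ℝ) + 1) * ((2 * n + 1).choose (k + 1) : ℝ)) else 0
  have hlow : ∑ k ∈ Finset.range n, (2 * n).choose k • f k = 0 :=
    Finset.sum_eq_zero fun k hk => by simp [f, not_le.mpr (Finset.mem_range.mp hk)]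
  have h := sum_card_erase_of_mem a f
  rw [Fintype.card_fin, Nat.add_sub_cancel,
    show Finset.range (2 * n + 1) = Finset.range (n + (n + 1)) by congr 1; omega,
    Finset.sum_range_add, hlow, zero_add] at h
  have hterm : ∀ i ∈ Finset.range (n + 1), (2 * n).choose (n + i) • f (n + i) =
      (((n + i : ℕ) : ℝ) + 1) / ((((2 * n : ℕ) : ℝ) + 1) * (((2 * n : ℕ) : ℝ) + 2)) := by
    intro i hi
    have hle : n + i ≤ 2 * n := by
      have := Finset.mem_range.mp hi
      omega
    rw [nsmul_eq_mul, ← choose_mul_shapley_weight hle]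
    simp only [f, if_pos (Nat.le_add_right n i)]
  rw [Finset.sum_congr rfl hterm, ← Finset.sum_div, sum_range_add_add_one] at h
  rw [← Finset.filter_filter, Finset.sum_filter]
  trans ∑ A ∈ Finset.univ.filter (fun A : Finset (Fin (2 * n + 1)) => a ∈ A),
    f (A.erase a).card
  · refine Finset.sum_congr (by congr) fun A hA => ?_
    simp only [f, Finset.card_erase_add_one (Finset.mem_filter.mp hA).2]
  · refine Eq.trans (by congr!) (h.trans ?_)
    push_cast
    field_simp
    ring
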